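/- arXiv:2203.09826 — 2 statements merged into one kernel-verified Lean document; each statement's English description precedes it below -/
import Mathlib

section
/- For every complex q with |q| < 1: ∑_{n≥0} q^{2n}/(1 − q^{5n+2}) − ∑_{n≥0} q^{3n+1}/(1 − q^{5n+3}) = (q, q^4, q^5, q^5; q^5)_∞ / (q^2, q^2, q^3, q^3; q^5)_∞. -/
/-!
Common definitions: for a partition `π` of `n`,
`numParts` is the number of parts, `largestPart` the largest part,
`omegaOnes` the number of parts equal to 1, `rank` and `crank` the
Dyson rank and Andrews–Garvan crank.  `NT m j n` is the total number of
parts over partitions of `n` with rank ≡ m (mod j), and `Mw m j n` is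
the total number of ones over partitions of `n` with crank ≡ m (mod j).
`poch a q = (a; q)_∞ = ∏_{n ≥ 0} (1 - a qⁿ)`.
-/

namespace Beck

/-- number of parts of a partition -/
def numParts {n : ℕ} (π : n.Partition) : ℕ := Multiset.card π.parts

/-- largest part of a partition (0 for the empty partition) -/
def largestPart {n : ℕ} (π : n.Partition) : ℕ := π.parts.sup

/-- number of ones in a partition -/
def omegaOnes {n : ℕ} (π : n.Partition) : ℕ := π.parts.count 1

/-- number of parts strictly larger than the number of ones -/
def muParts {n : ℕ} (π : n.Partition) : ℕ :=
  Multiset.card (π.parts.filter fun x => omegaOnes π < x)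

/-- Dyson's rank: largest part minus number of parts -/
def rank {n : ℕ} (π : n.Partition) : ℤ :=
  (largestPart π : ℤ) - (numParts π : ℤ)

/-- the Andrews–Garvan crank -/
def crank {n : ℕ} (π : n.Partition) : ℤ :=
  if omegaOnes π = 0 then (largestPart π : ℤ)
  else (muParts π : ℤ) - (omegaOnes π : ℤ)

/-- `NT m j n`: total number of parts in partitions of `n` with rank ≡ m (mod j) -/
def NT (m j n : ℕ) : ℤ :=
  ∑ π : n.Partition,
    if rank π % (j : ℤ) = (m : ℤ) % (j : ℤ) then (numParts π : ℤ) else 0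

/-- `Mw m j n`: total number of ones in partitions of `n` with crank ≡ m (mod j) -/
def Mw (m j n : ℕ) : ℤ :=
  ∑ π : n.Partition,
    if crank π % (j : ℤ) = (m : ℤ) % (j : ℤ) then (omegaOnes π : ℤ) else 0

/-- `(a; q)_∞ = ∏_{n ≥ 0} (1 - a qⁿ)` -/
noncomputable def poch (a q : ℂ) : ℂ := ∏' n : ℕ, (1 - a * q ^ n)

open Filter Topology Finset

/-- `(a; q)_n = ∏_{k < n} (1 - a q^k)` -/
noncomputable def finitePoch (a q : ℂ) (n : ℕ) : ℂ := ∏ k ∈ range n, (1 - a * q ^ k)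

lemma finitePoch_succ (a q : ℂ) (n : ℕ) :
    finitePoch a q (n + 1) = finitePoch a q n * (1 - a * q ^ n) :=
  prod_range_succ _ _

lemma finitePoch_add (a q : ℂ) (m n : ℕ) :
    finitePoch a q (m + n) = finitePoch a q m * finitePoch (a * q ^ m) q n := by
  simp [finitePoch, prod_range_add, pow_add, mul_assoc]

/-- Reversal of a finite `q`-Pochhammer symbol. -/
lemma finitePoch_div_pow {c q : ℂ} (hc : c ≠ 0) (hq : q ≠ 0) (n : ℕ) :
    finitePoch (c / q ^ n) q n = c ^ n * (∏ k ∈ range n, -(q ^ (k + 1))⁻¹) *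
      finitePoch (q / c) q n := by
  have hn : c ^ n = ∏ _k ∈ range n, c := by simp
  rw [finitePoch, finitePoch, ← prod_range_reflect, hn, ← prod_mul_distrib, ← prod_mul_distrib]
  refine prod_congr rfl fun k hk => ?_
  have hk : k < n := mem_range.1 hk
  obtain ⟨d, rfl⟩ := Nat.exists_eq_add_of_lt hk
  rw [show k + d + 1 - 1 - k = d by omega]
  field_simp
  ring

lemma finitePoch_div_pow_div {c d q : ℂ} (hc : c ≠ 0) (hd : d ≠ 0) (hq : q ≠ 0) (n : ℕ) :
    finitePoch (c / q ^ n) q n / finitePoch (d / q ^ n) q n =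
      (c / d) ^ n * (finitePoch (q / c) q n / finitePoch (q / d) q n) := by
  have h : ∏ k ∈ range n, -(q ^ (k + 1))⁻¹ ≠ 0 :=
    prod_ne_zero_iff.2 fun k _ => neg_ne_zero.2 (inv_ne_zero (pow_ne_zero _ hq))
  rw [finitePoch_div_pow hc hq, finitePoch_div_pow hd hq, div_pow]
  rw [mul_div_mul_comm, mul_div_mul_right _ _ h]

lemma partial_fraction_two_poles {w u v : ℂ} (hv : 1 - v ≠ 0) (hu : 1 - u ≠ 0)
    (huv : 1 - u * v ≠ 0) :
    (1 - w * u) / (1 - u) / (1 - v) =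
      (1 - w * (u * v)) / (1 - u * v) / (1 - v) -
        (1 - w) / (1 - u * v) / (-(1 - u) / u) := by
  field_simp
  ring

/-- Partial fraction expansion of `(xz; q)_M / (z; q)_{M+1}` in `z`. -/
lemma sum_partial_fractions {x q : ℂ} (hx : x ≠ 0) (hq : q ≠ 0) (hq1 : ∀ n : ℕ, q * q ^ n ≠ 1)
    (M : ℕ) (z : ℂ) (hz : ∀ m ≤ M, z * q ^ m ≠ 1) :
    ∑ m ∈ range (M + 1), x ^ m * (finitePoch (q / x) q m / finitePoch q q m *
        (finitePoch x q (M - m) / finitePoch q q (M - m))) / (1 - z * q ^ m) =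
      finitePoch (x * z) q M / finitePoch z q (M + 1) := by
  induction M generalizing z with
  | zero => simp [finitePoch]
  | succ M ih =>
    have hw : ∀ m ≤ M, 1 / q ^ (M + 1) * q ^ m ≠ 1 := by
      intro m hm h
      obtain ⟨d, rfl⟩ := Nat.exists_eq_add_of_le hm
      apply hq1 d
      field_simp at h
      have h2 : q ^ m * 1 = q ^ m * (q * q ^ d) := by linear_combination h
      exact (mul_left_cancel₀ (pow_ne_zero _ hq) h2).symm
    have ihz := ih z fun m hm => hz m (by omega)
    have ihw := ih (1 / q ^ (M + 1)) hw
    have hzM : 1 - z * q ^ (M + 1) ≠ 0 := sub_ne_zero.2 (hz (M + 1) le_rfl).symm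
    have key : ∀ m ∈ range (M + 1),
        x ^ m * (finitePoch (q / x) q m / finitePoch q q m *
          (finitePoch x q (M + 1 - m) / finitePoch q q (M + 1 - m))) / (1 - z * q ^ m) =
        (1 - x * z * q ^ M) / (1 - z * q ^ (M + 1)) *
          (x ^ m * (finitePoch (q / x) q m / finitePoch q q m *
            (finitePoch x q (M - m) / finitePoch q q (M - m))) / (1 - z * q ^ m)) -
        (1 - x / q) / (1 - z * q ^ (M + 1)) *
          (x ^ m * (finitePoch (q / x) q m / finitePoch q q m *
            (finitePoch x q (M - m) / finitePoch q q (M - m))) /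
              (1 - 1 / q ^ (M + 1) * q ^ m)) := by
      intro m hm
      have hmM : m ≤ M := by simpa [Nat.lt_succ_iff] using hm
      have h2 : 1 - z * q ^ m ≠ 0 := sub_ne_zero.2 (hz m (by omega)).symm
      obtain ⟨d, rfl⟩ := Nat.exists_eq_add_of_le hmM
      have h3 : 1 - q * q ^ d ≠ 0 := sub_ne_zero.2 (hq1 d).symm
      have h4 : 1 - 1 / q ^ (m + d + 1) * q ^ m = -(1 - q * q ^ d) / (q * q ^ d) := by
        field_simp
        ring
      rw [show m + d + 1 - m = d + 1 by omega, show m + d - m = d by omega, finitePoch_succ,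
        finitePoch_succ, h4, mul_div_mul_comm (finitePoch x q d)]
      generalize finitePoch (q / x) q m / finitePoch q q m = A
      generalize finitePoch x q d / finitePoch q q d = B
      have h5 := partial_fraction_two_poles (w := x / q) h2 h3
        (by rwa [show q * q ^ d * (z * q ^ m) = z * q ^ (m + d + 1) by ring])
      rw [show x / q * (q * q ^ d) = x * q ^ d by field_simp,
        show x / q * (q * q ^ d * (z * q ^ m)) = x * z * q ^ (m + d) by field_simp; ring,
        show q * q ^ d * (z * q ^ m) = z * q ^ (m + d + 1) by ring] at h5
      linear_combination x ^ m * A * B * h5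
    have hlast : x ^ (M + 1) * (finitePoch (q / x) q (M + 1) / finitePoch q q (M + 1)) =
        (1 - x / q) * (finitePoch (x * (1 / q ^ (M + 1))) q M /
          finitePoch (1 / q ^ (M + 1)) q (M + 1)) := by
      have h := finitePoch_div_pow_div hx one_ne_zero hq (M + 1)
      rw [div_one, div_one] at h
      rw [← h, finitePoch_succ (x / q ^ (M + 1)), mul_one_div,
        show x / q ^ (M + 1) * q ^ M = x / q by field_simp; ring]
      ring
    rw [sum_range_succ, sum_congr rfl key, sum_sub_distrib, ← mul_sum, ← mul_sum, ihz, ihw,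
      Nat.sub_self, finitePoch_succ (x * z), finitePoch_succ z (n := M + 1)]
    have h0 : finitePoch x q 0 / finitePoch q q 0 = 1 := by simp [finitePoch]
    rw [h0, mul_one, hlast, mul_div_mul_comm]
    ring

/-- Finite form of Kronecker's bilateral identity. -/
lemma sum_sub_sum_eq_finitePoch {x y q : ℂ} (hx : x ≠ 0) (hy : y ≠ 0) (hq : q ≠ 0)
    (hq1 : ∀ n : ℕ, q * q ^ n ≠ 1) (hy1 : ∀ n : ℕ, y * q ^ n ≠ 1)
    (hy2 : ∀ n : ℕ, q / y * q ^ n ≠ 1) (N : ℕ) :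
    ∑ n ∈ range (N + 1), x ^ n / (1 - y * q ^ n) *
        (finitePoch (q / x) q (N + n) / finitePoch q q (N + n) *
          (finitePoch x q (N - n) / finitePoch q q (N - n))) -
      ∑ n ∈ range N, (q / x) ^ (n + 1) / (y - q ^ (n + 1)) *
        (finitePoch (q / x) q (N - 1 - n) / finitePoch q q (N - 1 - n) *
          (finitePoch x q (N + 1 + n) / finitePoch q q (N + 1 + n))) =
      finitePoch (q / (x * y)) q N * finitePoch (x * y) q N /
        (finitePoch (q / y) q N * finitePoch y q (N + 1)) := by
  have hz : ∀ m ≤ N + N, y / q ^ N * q ^ m ≠ 1 := by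
    intro m _ h
    rcases le_or_gt N m with hm | hm
    · obtain ⟨d, rfl⟩ := Nat.exists_eq_add_of_le hm
      apply hy1 d
      rw [← h]
      field_simp
      ring
    · obtain ⟨d, rfl⟩ := Nat.exists_eq_add_of_lt hm
      apply hy2 d
      rw [← inv_eq_one] at h
      rw [← h]
      field_simp
      ring
  have h := sum_partial_fractions hx hq hq1 (N + N) (y / q ^ N) hz
  rw [finitePoch_add, add_assoc, finitePoch_add _ _ N (N + 1), mul_div_mul_comm,
    mul_div_assoc' x y, finitePoch_div_pow_div (mul_ne_zero hx hy) hy hq,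
    mul_div_cancel_right₀ _ hy, div_mul_cancel₀ _ (pow_ne_zero N hq),
    div_mul_cancel₀ _ (pow_ne_zero N hq), sum_range_add, ← sum_range_reflect] at h
  have hxN := pow_ne_zero N hx
  rw [mul_div_mul_comm, ← mul_right_inj' hxN, ← mul_assoc, ← h, mul_sub, mul_sum, mul_sum,
    add_comm (∑ n ∈ range N, _), sub_eq_add_neg, ← sum_neg_distrib]
  congr 1
  · refine sum_congr rfl fun n _ => ?_
    rw [show N + N - (N + n) = N - n by omega,
      show y / q ^ N * q ^ (N + n) = y * q ^ n by field_simp; ring]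
    ring
  · refine sum_congr rfl fun n hn => ?_
    have hn := mem_range.1 hn
    obtain ⟨d, rfl⟩ := Nat.exists_eq_add_of_lt hn
    rw [show n + d + 1 - 1 - n = d by omega,
      show n + d + 1 + (n + d + 1) - d = n + d + 1 + 1 + n by omega]
    generalize finitePoch (q / x) q d / finitePoch q q d *
      (finitePoch x q (n + d + 1 + 1 + n) / finitePoch q q (n + d + 1 + 1 + n)) = A
    have h1 : y - q ^ (n + 1) ≠ 0 := by
      intro h0
      apply hy2 n
      rw [sub_eq_zero.1 h0]
      field_simp
      ring
    have h2 : y / q ^ (n + d + 1) * q ^ d = y / q ^ (n + 1) := by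
      field_simp
      ring
    have h3 : 1 - y / q ^ (n + 1) = -(y - q ^ (n + 1)) / q ^ (n + 1) := by
      field_simp
      ring
    rw [h2, h3, div_pow]
    field_simp
    ring

lemma summable_norm_mul_pow (a : ℂ) {q : ℂ} (hq : ‖q‖ < 1) :
    Summable fun n : ℕ => ‖-(a * q ^ n)‖ := by
  simpa [norm_mul, norm_pow] using (summable_geometric_of_lt_one (norm_nonneg q) hq).mul_left ‖a‖

lemma tendsto_finitePoch (a : ℂ) {q : ℂ} (hq : ‖q‖ < 1) :
    Tendsto (finitePoch a q) atTop (𝓝 (poch a q)) := by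
  have h := (multipliable_one_add_of_summable (summable_norm_mul_pow a hq)).hasProd.tendsto_prod_nat
  simp only [← sub_eq_add_neg] at h
  exact h

lemma poch_ne_zero {a q : ℂ} (hq : ‖q‖ < 1) (h : ∀ n : ℕ, a * q ^ n ≠ 1) : poch a q ≠ 0 := by
  have := tprod_one_add_ne_zero_of_summable (f := fun n : ℕ => -(a * q ^ n))
    (fun n => by rw [← sub_eq_add_neg]; exact sub_ne_zero.2 (h n).symm) (summable_norm_mul_pow a hq)
  simp only [← sub_eq_add_neg] at this
  exact this

lemma exists_norm_le_of_tendsto {u : ℕ → ℂ} {l : ℂ} (h : Tendsto u atTop (𝓝 l)) :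
    ∃ C, ∀ n, ‖u n‖ ≤ C := by
  obtain ⟨C, hC⟩ := h.norm.bddAbove_range
  exact ⟨C, fun n => hC ⟨n, rfl⟩⟩

/-- Tannery's theorem for truncated sums `∑_{n < φ N} u n a_{i N n} b_{j N n}`. -/
lemma tendsto_sum_mul_of_tendsto {u a b : ℕ → ℂ} {α β : ℂ} (hu : Summable fun n => ‖u n‖)
    (ha : Tendsto a atTop (𝓝 α)) (hb : Tendsto b atTop (𝓝 β)) {φ : ℕ → ℕ} {i j : ℕ → ℕ → ℕ}
    (hφ : Tendsto φ atTop atTop) (hi : ∀ n, Tendsto (i · n) atTop atTop)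
    (hj : ∀ n, Tendsto (j · n) atTop atTop) :
    Tendsto (fun N => ∑ n ∈ range (φ N), u n * (a (i N n) * b (j N n))) atTop
      (𝓝 ((∑' n, u n) * (α * β))) := by
  obtain ⟨A, hA⟩ := exists_norm_le_of_tendsto ha
  obtain ⟨B, hB⟩ := exists_norm_le_of_tendsto hb
  have hA0 : 0 ≤ A := (norm_nonneg _).trans (hA 0)
  have hB0 : 0 ≤ B := (norm_nonneg _).trans (hB 0)
  have h := tendsto_tsum_of_dominated_convergence (𝓕 := atTop)
    (f := fun N n => if n < φ N then u n * (a (i N n) * b (j N n)) else 0)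
    (g := fun n => u n * (α * β)) (hu.mul_right (A * B)) ?_ ?_
  · rw [tsum_mul_right] at h
    refine h.congr fun N => ?_
    rw [tsum_eq_sum (s := range (φ N)) fun n hn => if_neg (by simpa using hn)]
    exact sum_congr rfl fun n hn => if_pos (mem_range.1 hn)
  · intro n
    refine (tendsto_const_nhds.mul ((ha.comp (hi n)).mul (hb.comp (hj n)))).congr' ?_
    filter_upwards [hφ.eventually_gt_atTop n] with N hN
    simp [hN]
  · refine Eventually.of_forall fun N n => ?_
    split_ifs
    · rw [norm_mul, norm_mul]
      gcongr
      · exact hA _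
      · exact hB _
    · rw [norm_zero]
      positivity

lemma summable_norm_pow_div {r : ℂ} (hr : ‖r‖ < 1) {u : ℕ → ℂ} {l : ℂ} (hl : l ≠ 0)
    (hu : Tendsto u atTop (𝓝 l)) : Summable fun n : ℕ => ‖r ^ n / u n‖ := by
  obtain ⟨C, hC⟩ := exists_norm_le_of_tendsto (hu.inv₀ hl)
  refine ((summable_geometric_of_lt_one (norm_nonneg r) hr).mul_right C).of_nonneg_of_le
    (fun n => norm_nonneg _) fun n => ?_
  rw [div_eq_mul_inv, norm_mul, norm_pow]
  gcongr
  exact hC n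

/-- Kronecker's bilateral identity: for `|q| < |x| < 1`,
`∑_{n ∈ ℤ} xⁿ / (1 - y qⁿ) = (xy, q/(xy), q, q; q)_∞ / (x, q/x, y, q/y; q)_∞`. -/
theorem tsum_sub_tsum_eq_poch {x y q : ℂ} (hq : q ≠ 0) (hqx : ‖q‖ < ‖x‖) (hx1 : ‖x‖ < 1)
    (hy : y ≠ 0) (hy1 : ∀ n : ℕ, y * q ^ n ≠ 1) (hy2 : ∀ n : ℕ, q / y * q ^ n ≠ 1) :
    ∑' n : ℕ, x ^ n / (1 - y * q ^ n) - ∑' n : ℕ, (q / x) ^ (n + 1) / (y - q ^ (n + 1)) =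
      poch (q / (x * y)) q * poch (x * y) q * poch q q * poch q q /
        (poch x q * poch (q / x) q * poch y q * poch (q / y) q) := by
  have hq1 : ‖q‖ < 1 := hqx.trans hx1
  have hx : x ≠ 0 := norm_pos_iff.1 ((norm_nonneg q).trans_lt hqx)
  have hqx1 : ‖q / x‖ < 1 := by
    rw [norm_div]
    exact (div_lt_one (norm_pos_iff.2 hx)).2 hqx
  have hne : ∀ a : ℂ, ‖a‖ < 1 → ∀ n : ℕ, a * q ^ n ≠ 1 := by
    intro a ha n h
    have h1 : ‖a * q ^ n‖ < 1 := by
      rw [norm_mul, norm_pow]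
      exact mul_lt_one_of_nonneg_of_lt_one_left (norm_nonneg _) ha
        (pow_le_one₀ (norm_nonneg _) hq1.le)
    rw [h, norm_one] at h1
    exact lt_irrefl _ h1
  have hpow : Tendsto (fun n : ℕ => q ^ n) atTop (𝓝 0) :=
    tendsto_pow_atTop_nhds_zero_of_norm_lt_one hq1
  have hqq := poch_ne_zero hq1 (hne q hq1)
  have hs1 : Summable fun n : ℕ => ‖x ^ n / (1 - y * q ^ n)‖ :=
    summable_norm_pow_div hx1 one_ne_zero (by simpa using (hpow.const_mul y).const_sub 1)
  have hs2 : Summable fun n : ℕ => ‖(q / x) ^ (n + 1) / (y - q ^ (n + 1))‖ :=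
    (summable_nat_add_iff (f := fun n : ℕ => ‖(q / x) ^ n / (y - q ^ n)‖) 1).2
      (summable_norm_pow_div hqx1 hy (by simpa using hpow.const_sub y))
  have ha := (tendsto_finitePoch (q / x) hq1).div (tendsto_finitePoch q hq1) hqq
  have hb := (tendsto_finitePoch x hq1).div (tendsto_finitePoch q hq1) hqq
  have ht1 := tendsto_sum_mul_of_tendsto hs1 ha hb (φ := fun N => N + 1)
    (i := fun N n => N + n) (j := fun N n => N - n) (tendsto_add_atTop_nat 1)
    tendsto_add_atTop_nat tendsto_sub_atTop_nat
  have ht2 := tendsto_sum_mul_of_tendsto hs2 ha hb (φ := fun N => N)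
    (i := fun N n => N - 1 - n) (j := fun N n => N + 1 + n) tendsto_id
    (fun n => (tendsto_sub_atTop_nat n).comp (tendsto_sub_atTop_nat 1))
    (fun n => (tendsto_add_atTop_nat n).comp (tendsto_add_atTop_nat 1))
  have hyp := poch_ne_zero hq1 hy1
  have hyp2 := poch_ne_zero hq1 hy2
  have ht3 := ((tendsto_finitePoch (q / (x * y)) hq1).mul (tendsto_finitePoch (x * y) hq1)).div
    ((tendsto_finitePoch (q / y) hq1).mul
      ((tendsto_finitePoch y hq1).comp (tendsto_add_atTop_nat 1))) (mul_ne_zero hyp2 hyp)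
  have h := tendsto_nhds_unique ((ht1.sub ht2).congr
    fun N => sum_sub_sum_eq_finitePoch hx hy hq (hne q hq1) hy1 hy2 N) ht3
  have hxp := poch_ne_zero hq1 (hne x hx1)
  have hxp2 := poch_ne_zero hq1 (hne (q / x) hqx1)
  rw [← sub_mul] at h
  rw [eq_div_iff (by simp [*])]
  field_simp at h
  rw [mul_comm y x] at h
  linear_combination h

/-- Identity (2.6):
`∑_{n≥0} q^{2n}/(1 − q^{5n+2}) − ∑_{n≥0} q^{3n+1}/(1 − q^{5n+3})
  = (q, q⁴, q⁵, q⁵; q⁵)_∞ / (q², q², q³, q³; q⁵)_∞` for `|q| < 1`. -/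
theorem statement_9 (q : ℂ) (hq : ‖q‖ < 1) :
    (∑' n : ℕ, q ^ (2 * n) / (1 - q ^ (5 * n + 2)))
      - ∑' n : ℕ, q ^ (3 * n + 1) / (1 - q ^ (5 * n + 3))
    = (poch q (q ^ 5) * poch (q ^ 4) (q ^ 5)
        * poch (q ^ 5) (q ^ 5) * poch (q ^ 5) (q ^ 5))
      / (poch (q ^ 2) (q ^ 5) * poch (q ^ 2) (q ^ 5)
        * poch (q ^ 3) (q ^ 5) * poch (q ^ 3) (q ^ 5)) := by
  rcases eq_or_ne q 0 with rfl | hq0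
  · rw [tsum_eq_single 0 fun n hn => by simp [hn]]
    simp [poch]
  have hn1 : ∀ k : ℕ, q ^ (k + 1) ≠ 1 := by
    intro k h
    have h1 := pow_lt_one₀ (norm_nonneg q) hq (Nat.succ_ne_zero k)
    rw [← norm_pow, h, norm_one] at h1
    exact lt_irrefl _ h1
  have hlt : ‖q ^ 5‖ < ‖q ^ 2‖ := by
    rw [norm_pow, norm_pow]
    exact pow_lt_pow_right_of_lt_one₀ (norm_pos_iff.2 hq0) hq (by norm_num)
  have hlt1 : ‖q ^ 2‖ < 1 := by
    rw [norm_pow]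
    exact pow_lt_one₀ (norm_nonneg q) hq two_ne_zero
  have e1 : q ^ 5 / q ^ 2 = q ^ 3 := by field_simp
  have e2 : q ^ 5 / (q ^ 2 * q ^ 2) = q := by field_simp
  have h := tsum_sub_tsum_eq_poch (pow_ne_zero 5 hq0) hlt hlt1 (pow_ne_zero 2 hq0)
    (fun n => by
      rw [← pow_mul, ← pow_add, show 2 + 5 * n = 5 * n + 1 + 1 by ring]
      exact hn1 _)
    (fun n => by
      rw [e1, ← pow_mul, ← pow_add, show 3 + 5 * n = 5 * n + 2 + 1 by ring]
      exact hn1 _)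
  rw [e1, e2, ← pow_add] at h
  have s1 : ∀ n : ℕ, (q ^ 2) ^ n / (1 - q ^ 2 * (q ^ 5) ^ n) =
      q ^ (2 * n) / (1 - q ^ (5 * n + 2)) := by
    intro n
    rw [← pow_mul, ← pow_mul, ← pow_add, add_comm 2]
  have s2 : ∀ n : ℕ, (q ^ 3) ^ (n + 1) / (q ^ 2 - (q ^ 5) ^ (n + 1)) =
      q ^ (3 * n + 1) / (1 - q ^ (5 * n + 3)) := by
    intro n
    rw [← mul_div_mul_left _ (1 - q ^ (5 * n + 3)) (pow_ne_zero 2 hq0)]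
    ring_nf
  rw [tsum_congr s1, tsum_congr s2] at h
  rw [h]
  ring

end Beck
end

section
/- For every complex q with |q| < 1: ∑_{n≥0} q^{2n+1}/(1 − q^{5n+2}) − ∑_{n≥0} q^{3n+2}/(1 − q^{5n+3}) = q · (q, q^4, q^5, q^5; q^5)_∞ / (q^2, q^2, q^3, q^3; q^5)_∞. -/
/-!
Common definitions: for a partition `π` of `n`,
`numParts` is the number of parts, `largestPart` the largest part,
`omegaOnes` the number of parts equal to 1, `rank` and `crank` the
Dyson rank and Andrews–Garvan crank.  `NT m j n` is the total number of
parts over partitions of `n` with rank ≡ m (mod j), and `Mw m j n` is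
the total number of ones over partitions of `n` with crank ≡ m (mod j).
`poch a q = (a; q)_∞ = ∏_{n ≥ 0} (1 - a qⁿ)`.
-/

namespace Beck

open Filter Topology Finset

/-- the finite `q`-Pochhammer symbol `(a; p)_n` -/
noncomputable def finPoch (a p : ℂ) (n : ℕ) : ℂ := ∏ j ∈ range n, (1 - a * p ^ j)

lemma finPoch_succ (a p : ℂ) (n : ℕ) :
    finPoch a p (n + 1) = finPoch a p n * (1 - a * p ^ n) :=
  prod_range_succ _ _

lemma finPoch_ne_zero {a p : ℂ} {n : ℕ} (h : ∀ j < n, 1 - a * p ^ j ≠ 0) :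
    finPoch a p n ≠ 0 :=
  prod_ne_zero_iff.2 fun j hj => h j (mem_range.1 hj)

lemma finPoch_div_pow_add {p : ℂ} (hp : p ≠ 0) (a : ℂ) (n m : ℕ) :
    finPoch (a / p ^ n) p (n + m) = finPoch (a / p ^ n) p n * finPoch a p m := by
  unfold finPoch
  rw [prod_range_add]
  congr 1
  refine prod_congr rfl fun j _ => ?_
  rw [pow_add]
  field_simp

lemma finPoch_div_pow {p a : ℂ} (hp : p ≠ 0) (ha : a ≠ 0) (n : ℕ) :
    finPoch (a / p ^ n) p n =
      a ^ n * (∏ j ∈ range n, (-1 / p ^ (j + 1))) * finPoch (p / a) p n := by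
  induction n with
  | zero => simp [finPoch]
  | succ n ih =>
    have h : finPoch (a / p ^ (n + 1)) p (n + 1)
        = finPoch (a / p ^ n) p n * (1 - a / p ^ (n + 1)) := by
      unfold finPoch
      rw [prod_range_succ']
      congr 1
      · refine prod_congr rfl fun j _ => ?_
        field_simp
        ring
      · simp
    rw [h, ih, finPoch_succ, prod_range_succ]
    have h2 : 1 - a / p ^ (n + 1) = a * (-1 / p ^ (n + 1)) * (1 - p / a * p ^ n) := by
      field_simp
      ring
    rw [h2]
    ring

lemma one_sub_ne_zero_of_norm_lt {z : ℂ} (hz : ‖z‖ < 1) : 1 - z ≠ 0 := by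
  intro h
  rw [← sub_eq_zero.1 h] at hz
  simp at hz

lemma norm_mul_pow_le {a p : ℂ} (hp : ‖p‖ < 1) (n : ℕ) : ‖a * p ^ n‖ ≤ ‖a‖ := by
  rw [norm_mul, norm_pow]
  exact mul_le_of_le_one_right (norm_nonneg _) (pow_le_one₀ (norm_nonneg _) hp.le)

lemma one_sub_mul_pow_ne_zero {a p : ℂ} (ha : ‖a‖ < 1) (hp : ‖p‖ < 1) (n : ℕ) :
    1 - a * p ^ n ≠ 0 :=
  one_sub_ne_zero_of_norm_lt ((norm_mul_pow_le hp n).trans_lt ha)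

lemma summable_norm_neg_mul_pow (a : ℂ) {p : ℂ} (hp : ‖p‖ < 1) :
    Summable fun n : ℕ => ‖-(a * p ^ n)‖ := by
  simpa [norm_mul, norm_pow] using
    (summable_geometric_of_lt_one (norm_nonneg p) hp).mul_left ‖a‖

lemma tendsto_finPoch (a : ℂ) {p : ℂ} (hp : ‖p‖ < 1) :
    Tendsto (finPoch a p) atTop (𝓝 (poch a p)) := by
  have h := (multipliable_one_add_of_summable
    (summable_norm_neg_mul_pow a hp)).tendsto_prod_tprod_nat
  simp only [← sub_eq_add_neg] at h
  exact h

lemma poch_ne_zero_s14 {a p : ℂ} (ha : ‖a‖ < 1) (hp : ‖p‖ < 1) : poch a p ≠ 0 := by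
  have h := tprod_one_add_ne_zero_of_summable (f := fun n : ℕ => -(a * p ^ n))
    (fun n => by simpa only [← sub_eq_add_neg] using one_sub_mul_pow_ne_zero ha hp n)
    (summable_norm_neg_mul_pow a hp)
  simp only [← sub_eq_add_neg] at h
  exact h

/-- Partial fraction expansion of `(by; p)_L / (b; p)_{L+1}` in the variable `b`. -/
lemma finPoch_div_eq_sum {p y : ℂ} (hp0 : p ≠ 0) (hp : ‖p‖ < 1) (hy : y ≠ 0) (L : ℕ) :
    ∀ b : ℂ, (∀ k ≤ L, 1 - b * p ^ k ≠ 0) →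
      finPoch (b * y) p L / finPoch b p (L + 1) =
        ∑ k ∈ range (L + 1), y ^ k * (finPoch (p / y) p k / finPoch p p k)
          * (finPoch y p (L - k) / finPoch p p (L - k)) / (1 - b * p ^ k) := by
  have hpow : ∀ n : ℕ, 1 - p * p ^ n ≠ 0 := one_sub_mul_pow_ne_zero hp hp
  have hP : ∀ n, finPoch p p n ≠ 0 := fun n => finPoch_ne_zero fun j _ => hpow j
  induction L with
  | zero => intro b _; simp [finPoch]
  | succ L ih =>
    intro b hb
    have hb' : ∀ k ≤ L, 1 - 1 / p ^ (L + 1) * p ^ k ≠ 0 := by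
      intro k hk h
      obtain ⟨m, rfl⟩ := Nat.exists_eq_add_of_le hk
      apply hpow m
      have : 1 / p ^ (k + m + 1) * p ^ k * p ^ (m + 1) = 1 := by
        field_simp
        ring
      rw [← sub_eq_zero.1 h] at this
      rw [← this]
      ring
    have hlast : (1 - y / p) * (finPoch (1 / p ^ (L + 1) * y) p L
          / finPoch (1 / p ^ (L + 1)) p (L + 1))
        = y ^ (L + 1) * (finPoch (p / y) p (L + 1) / finPoch p p (L + 1)) := by
      have h1 := finPoch_div_pow hp0 hy (L + 1)
      have h2 := finPoch_div_pow hp0 one_ne_zero (L + 1)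
      have hK : (∏ j ∈ range (L + 1), (-1 / p ^ (j + 1))) ≠ 0 :=
        prod_ne_zero_iff.2 fun j _ => by simp [hp0]
      have h3 : (1 : ℂ) - y / p ^ (L + 1) * p ^ L = 1 - y / p := by
        field_simp
        ring
      rw [finPoch_succ, h3] at h1
      rw [one_pow, one_mul, div_one] at h2
      have h4 : 1 / p ^ (L + 1) * y = y / p ^ (L + 1) := by ring
      rw [h4, ← mul_div_assoc, mul_comm, h1, h2, mul_right_comm, mul_comm _ (finPoch p p (L + 1)),
        mul_div_mul_right _ _ hK, mul_div_assoc]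
    rw [sum_range_succ, Nat.sub_self, ← hlast, ih _ hb', finPoch_succ, finPoch_succ _ _ (L + 1),
      mul_div_mul_comm, ih b fun k hk => hb k (hk.trans L.le_succ), sum_mul, mul_sum]
    simp only [finPoch, range_zero, prod_empty, div_one, mul_one]
    simp only [← finPoch.eq_1]
    rw [sum_div, ← sum_add_distrib]
    refine sum_congr rfl fun k hk => ?_
    have hk' : k ≤ L := Nat.lt_succ_iff.1 (mem_range.1 hk)
    have e1 := hb k (hk'.trans L.le_succ)
    have e2 := hb (L + 1) le_rfl
    obtain ⟨m, rfl⟩ := Nat.exists_eq_add_of_le hk'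
    rw [show k + m + 1 - k = m + 1 by omega, show k + m - k = m by omega, finPoch_succ,
      finPoch_succ]
    have e4 := hpow m
    have key : (1 - b * y * p ^ (k + m)) / (1 - b * p ^ (k + m + 1)) / (1 - b * p ^ k)
        = (1 - y * p ^ m) / (1 - p * p ^ m) / (1 - b * p ^ k)
          + (1 - y / p) / (1 - 1 / p ^ (k + m + 1) * p ^ k) / (1 - b * p ^ (k + m + 1)) := by
      have e5 : 1 - 1 / p ^ (k + m + 1) * p ^ k = -(1 - p * p ^ m) / (p * p ^ m) := by
        rw [show k + m + 1 = k + (m + 1) by ring, pow_add]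
        field_simp
        ring
      have e6 : (1 - y / p) * (p * p ^ m) = (p - y) * p ^ m := by
        field_simp
      rw [e5, div_div_eq_mul_div, e6, div_div, div_div, div_div,
        div_add_div _ _ (mul_ne_zero e4 e1) (mul_ne_zero (neg_ne_zero.2 e4) e2),
        div_eq_div_iff (mul_ne_zero e2 e1)
          (mul_ne_zero (mul_ne_zero e4 e1) (mul_ne_zero (neg_ne_zero.2 e4) e2))]
      ring
    rw [mul_div_mul_comm]
    linear_combination (y ^ k * (finPoch (p / y) p k / finPoch p p k)
          * (finPoch y p m / finPoch p p m)) * key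

/-- The symmetric truncation of the bilateral sum `∑ xⁿ / (1 - a pⁿ)`. -/
lemma finPoch_div_eq_sum_sub_sum {p a x : ℂ} (hp0 : p ≠ 0) (ha0 : a ≠ 0) (hx0 : x ≠ 0)
    (hp : ‖p‖ < 1) (ha : ‖a‖ < 1) (hpa : ‖p / a‖ < 1) (N : ℕ) :
    finPoch (a * x) p N * finPoch (p / (a * x)) p N
        / (finPoch a p (N + 1) * finPoch (p / a) p N) =
      ∑ n ∈ range (N + 1), x ^ n / (1 - a * p ^ n)
          * ((finPoch (p / x) p (N + n) / finPoch p p (N + n))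
            * (finPoch x p (N - n) / finPoch p p (N - n)))
      - ∑ n ∈ range N, p / (a * x) * (p / x) ^ n / (1 - p / a * p ^ n)
          * ((finPoch (p / x) p (N - 1 - n) / finPoch p p (N - 1 - n))
            * (finPoch x p (N + 1 + n) / finPoch p p (N + 1 + n))) := by
  have hneg : ∀ n : ℕ, 1 - a / p ^ (n + 1) = -(a / p ^ (n + 1)) * (1 - p / a * p ^ n) := by
    intro n
    field_simp
    ring
  have hshift : ∀ n : ℕ, a / p ^ N * p ^ (N + n) = a * p ^ n := by
    intro n
    rw [pow_add]
    field_simp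
  have hshift' : ∀ n < N, a / p ^ N * p ^ (N - 1 - n) = a / p ^ (n + 1) := by
    intro n hn
    obtain ⟨m, rfl⟩ := Nat.exists_eq_add_of_lt hn
    rw [show n + m + 1 - 1 - n = m by omega]
    field_simp
    ring
  have hb : ∀ k ≤ N + N, 1 - a / p ^ N * p ^ k ≠ 0 := by
    intro k _
    rcases lt_or_ge k N with h | h
    · have := hshift' (N - 1 - k) (by omega)
      rw [show N - 1 - (N - 1 - k) = k by omega] at this
      rw [this, hneg]
      exact mul_ne_zero (by simp [ha0, hp0]) (one_sub_mul_pow_ne_zero hpa hp _)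
    · obtain ⟨n, rfl⟩ := Nat.exists_eq_add_of_le h
      rw [hshift]
      exact one_sub_mul_pow_ne_zero ha hp n
  have hmain := finPoch_div_eq_sum hp0 hp hx0 (N + N) (a / p ^ N) hb
  have hK : (∏ j ∈ range N, (-1 / p ^ (j + 1))) ≠ 0 :=
    prod_ne_zero_iff.2 fun j _ => by simp [hp0]
  have hA : finPoch a p (N + 1) ≠ 0 := finPoch_ne_zero fun j _ => one_sub_mul_pow_ne_zero ha hp j
  have hV : finPoch (p / a) p N ≠ 0 := finPoch_ne_zero fun j _ => one_sub_mul_pow_ne_zero hpa hp j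
  have hL : finPoch (a / p ^ N * x) p (N + N) / finPoch (a / p ^ N) p (N + N + 1)
      = x ^ N * (finPoch (a * x) p N * finPoch (p / (a * x)) p N
        / (finPoch a p (N + 1) * finPoch (p / a) p N)) := by
    rw [show a / p ^ N * x = a * x / p ^ N by ring, finPoch_div_pow_add hp0, add_assoc,
      finPoch_div_pow_add hp0, finPoch_div_pow hp0 ha0, finPoch_div_pow hp0 (mul_ne_zero ha0 hx0),
      mul_pow]
    generalize (∏ j ∈ range N, (-1 / p ^ (j + 1))) = K at hK ⊢
    field_simp
  rw [hL] at hmain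
  apply mul_left_cancel₀ (pow_ne_zero N hx0)
  rw [hmain, add_assoc, sum_range_add, ← sum_range_reflect, mul_sub, mul_sum, mul_sum,
    sub_eq_add_neg, ← sum_neg_distrib, add_comm]
  congr 1
  · refine sum_congr rfl fun n _ => ?_
    rw [hshift, show N + N - (N + n) = N - n by omega, pow_add]
    ring
  · refine sum_congr rfl fun n hn => ?_
    have hn' := mem_range.1 hn
    rw [hshift' n hn', hneg, show N + N - (N - 1 - n) = N + 1 + n by omega]
    have hx : x ^ N = x ^ (N - 1 - n) * x ^ (n + 1) := by
      rw [← pow_add]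
      congr 1
      omega
    have hV' := one_sub_mul_pow_ne_zero hpa hp n
    rw [hx]
    generalize finPoch (p / x) p (N - 1 - n) / finPoch p p (N - 1 - n) = A
    generalize finPoch x p (N + 1 + n) / finPoch p p (N + 1 + n) = B
    generalize 1 - p / a * p ^ n = D at hV' ⊢
    rw [div_pow]
    field_simp
    ring

lemma summable_pow_div_one_sub {a p x : ℂ} (hx : ‖x‖ < 1) (ha : ‖a‖ < 1) (hp : ‖p‖ < 1) :
    Summable fun n : ℕ => ‖x ^ n / (1 - a * p ^ n)‖ := by
  refine Summable.of_nonneg_of_le (fun _ => norm_nonneg _) (fun n => ?_)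
    ((summable_geometric_of_lt_one (norm_nonneg x) hx).mul_right (1 - ‖a‖)⁻¹)
  rw [norm_div, norm_pow, div_eq_mul_inv]
  have h1 : 0 < 1 - ‖a‖ := by linarith
  have h2 : 1 - ‖a‖ ≤ ‖1 - a * p ^ n‖ := by
    have := norm_sub_norm_le (1 : ℂ) (a * p ^ n)
    have := norm_mul_pow_le (a := a) hp n
    rw [norm_one] at *
    linarith
  gcongr

/-- Partial sums weighted by bounded, pointwise convergent factors. -/
lemma tendsto_sum_range_mul {g : ℕ → ℂ} {h : ℕ → ℕ → ℂ} {l : ℂ} {C : ℝ} {M : ℕ → ℕ}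
    (hg : Summable fun n => ‖g n‖) (hM : Tendsto M atTop atTop) (hC : ∀ N n, ‖h N n‖ ≤ C)
    (hl : ∀ n, Tendsto (fun N => h N n) atTop (𝓝 l)) :
    Tendsto (fun N => ∑ n ∈ range (M N), g n * h N n) atTop (𝓝 ((∑' n, g n) * l)) := by
  have hT := tendsto_tsum_of_dominated_convergence (𝓕 := atTop)
    (f := fun N n => if n < M N then g n * h N n else 0) (g := fun n => g n * l)
    (hg.mul_right C) (fun n => ?_) (Eventually.of_forall fun N n => ?_)
  · rw [tsum_mul_right] at hT
    refine hT.congr fun N => ?_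
    rw [tsum_eq_sum (s := range (M N)) fun n hn => if_neg (by simpa using hn)]
    exact sum_congr rfl fun n hn => if_pos (mem_range.1 hn)
  · refine ((hl n).const_mul (g n)).congr' ?_
    filter_upwards [hM.eventually_gt_atTop n] with N hN
    rw [if_pos hN]
  · have hb : ‖g n * h N n‖ ≤ ‖g n‖ * C := by
      rw [norm_mul]
      exact mul_le_mul_of_nonneg_left (hC N n) (norm_nonneg _)
    split_ifs
    · exact hb
    · rw [norm_zero]
      exact (norm_nonneg _).trans hb

/-- The case `b = aq` of Ramanujan's `₁ψ₁` summation, as a difference of two unilateral sums. -/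
theorem tsum_sub_tsum_eq_poch_s14 {p a x : ℂ} (hp0 : p ≠ 0) (ha0 : a ≠ 0) (hx0 : x ≠ 0)
    (hp : ‖p‖ < 1) (ha : ‖a‖ < 1) (hx : ‖x‖ < 1) (hpa : ‖p / a‖ < 1) (hpx : ‖p / x‖ < 1) :
    (∑' n : ℕ, x ^ n / (1 - a * p ^ n))
        - ∑' n : ℕ, p / (a * x) * (p / x) ^ n / (1 - p / a * p ^ n) =
      poch (a * x) p * poch (p / (a * x)) p * poch p p * poch p p
        / (poch a p * poch (p / a) p * poch x p * poch (p / x) p) := by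
  have hratio : ∀ z, Tendsto (fun n => finPoch z p n / finPoch p p n) atTop
      (𝓝 (poch z p / poch p p)) := fun z =>
    (tendsto_finPoch z hp).div (tendsto_finPoch p hp) (poch_ne_zero_s14 hp hp)
  have hbdd : ∀ z, ∃ C : ℝ, ∀ n, ‖finPoch z p n / finPoch p p n‖ ≤ C := fun z => by
    obtain ⟨C, hC⟩ := (Metric.isBounded_range_of_tendsto _ (hratio z)).exists_norm_le
    exact ⟨C, fun n => hC _ ⟨n, rfl⟩⟩
  obtain ⟨C, hC⟩ := hbdd (p / x)
  obtain ⟨D, hD⟩ := hbdd x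
  have hCD : ∀ m n, ‖(finPoch (p / x) p m / finPoch p p m)
      * (finPoch x p n / finPoch p p n)‖ ≤ C * D := fun m n => by
    rw [norm_mul]
    exact mul_le_mul (hC m) (hD n) (norm_nonneg _) ((norm_nonneg _).trans (hC m))
  have hlim : ∀ {s t : ℕ → ℕ}, Tendsto s atTop atTop → Tendsto t atTop atTop →
      Tendsto (fun N => (finPoch (p / x) p (s N) / finPoch p p (s N))
        * (finPoch x p (t N) / finPoch p p (t N))) atTop
        (𝓝 (poch (p / x) p / poch p p * (poch x p / poch p p))) := fun hs ht =>
    ((hratio _).comp hs).mul ((hratio _).comp ht)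
  have h1 := tendsto_sum_range_mul (summable_pow_div_one_sub hx ha hp)
    (tendsto_add_atTop_nat 1) (fun N n => hCD (N + n) (N - n))
    (fun n => hlim (tendsto_add_atTop_nat n) (tendsto_sub_atTop_nat n))
  have hsum : Summable fun n : ℕ => ‖p / (a * x) * (p / x) ^ n / (1 - p / a * p ^ n)‖ := by
    simpa only [mul_div_assoc, norm_mul] using
      (summable_pow_div_one_sub hpx hpa hp).mul_left ‖p / (a * x)‖
  have h2 := tendsto_sum_range_mul hsum tendsto_id (fun N n => hCD (N - 1 - n) (N + 1 + n))
    (fun n => hlim ((tendsto_sub_atTop_nat n).comp (tendsto_sub_atTop_nat 1))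
      ((tendsto_add_atTop_nat n).comp (tendsto_add_atTop_nat 1)))
  have h3 := ((tendsto_finPoch (a * x) hp).mul (tendsto_finPoch (p / (a * x)) hp)).div
    (((tendsto_finPoch a hp).comp (tendsto_add_atTop_nat 1)).mul (tendsto_finPoch (p / a) hp))
    (mul_ne_zero (poch_ne_zero_s14 ha hp) (poch_ne_zero_s14 hpa hp))
  have h4 := tendsto_nhds_unique (h3.congr fun N =>
    finPoch_div_eq_sum_sub_sum hp0 ha0 hx0 hp ha hpa N) (h1.sub h2)
  rw [← sub_mul] at h4
  have n1 := poch_ne_zero_s14 hp hp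
  have n2 := poch_ne_zero_s14 ha hp
  have n3 := poch_ne_zero_s14 hpa hp
  have n4 := poch_ne_zero_s14 hx hp
  have n5 := poch_ne_zero_s14 hpx hp
  generalize (∑' n : ℕ, x ^ n / (1 - a * p ^ n))
    - ∑' n : ℕ, p / (a * x) * (p / x) ^ n / (1 - p / a * p ^ n) = S at h4 ⊢
  field_simp at h4 ⊢
  linear_combination -h4

/-- Identity (2.14) ("v-1"):
`∑_{n≥0} q^{2n+1}/(1 − q^{5n+2}) − ∑_{n≥0} q^{3n+2}/(1 − q^{5n+3})
  = q (q, q⁴, q⁵, q⁵; q⁵)_∞ / (q², q², q³, q³; q⁵)_∞` for `|q| < 1`. -/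
theorem statement_14 (q : ℂ) (hq : ‖q‖ < 1) :
    (∑' n : ℕ, q ^ (2 * n + 1) / (1 - q ^ (5 * n + 2)))
      - ∑' n : ℕ, q ^ (3 * n + 2) / (1 - q ^ (5 * n + 3))
    = q * (poch q (q ^ 5) * poch (q ^ 4) (q ^ 5)
        * poch (q ^ 5) (q ^ 5) * poch (q ^ 5) (q ^ 5))
      / (poch (q ^ 2) (q ^ 5) * poch (q ^ 2) (q ^ 5)
        * poch (q ^ 3) (q ^ 5) * poch (q ^ 3) (q ^ 5)) := by
  rcases eq_or_ne q 0 with rfl | h0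
  · simp
  have hlt : ∀ n : ℕ, n ≠ 0 → ‖q ^ n‖ < 1 := fun n hn => by
    rw [norm_pow]
    exact pow_lt_one₀ (norm_nonneg _) hq hn
  have e1 : q ^ 5 / q ^ 2 = q ^ 3 := by field_simp
  have e2 : q ^ 5 / (q ^ 2 * q ^ 2) = q := by field_simp
  have e3 : q ^ 2 * q ^ 2 = q ^ 4 := by ring
  have h := tsum_sub_tsum_eq_poch_s14 (pow_ne_zero 5 h0) (pow_ne_zero 2 h0) (pow_ne_zero 2 h0)
    (hlt 5 (by simp)) (hlt 2 (by simp)) (hlt 2 (by simp))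
    (by rw [e1]; exact hlt 3 (by simp)) (by rw [e1]; exact hlt 3 (by simp))
  rw [e2, e1, e3] at h
  have s1 : ∀ n : ℕ, q ^ (2 * n + 1) / (1 - q ^ (5 * n + 2))
      = q * ((q ^ 2) ^ n / (1 - q ^ 2 * (q ^ 5) ^ n)) := fun n => by ring
  have s2 : ∀ n : ℕ, q ^ (3 * n + 2) / (1 - q ^ (5 * n + 3))
      = q * (q * (q ^ 3) ^ n / (1 - q ^ 3 * (q ^ 5) ^ n)) := fun n => by ring
  simp only [s1, s2]
  rw [tsum_mul_left, tsum_mul_left, ← mul_sub, h]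
  ring

end Beck
end
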